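/- Let m ≥ 1 and let α ∈ ℝ^m be badly approximable. Then for every θ with 0 < θ < 1/m² there exists C > 0 such that for every integer N ≥ 1 and all y, z ∈ ℝ^m there exist j ∈ {0, 1, …, N−1} and k ∈ ℤ^m with ‖z − y − j·α − k‖ ≤ C·N^{−θ}. Equivalently, every orbit segment {y, y+α, …, y+(N−1)α} of the translation by α on the torus ℝ^m/ℤ^m is C·N^{−θ}-dense. -/

import Mathlib

/-- `OrbE α N r n x`: `x` is within `n r` of some `jα` mod `ℤ^m` with `|j| ≤ nN`. -/
def OrbE {m : ℕ} (α : Fin m → ℝ) (N : ℕ) (r : ℝ) (n : ℕ) (x : Fin m → ℝ) : Prop :=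
  ∃ j : ℤ, |j| ≤ (n : ℤ) * N ∧ ∃ k : Fin m → ℤ, ∀ i, |x i - j * α i - k i| ≤ n * r

lemma OrbE.add {m : ℕ} {α : Fin m → ℝ} {N : ℕ} {r : ℝ} {a b : ℕ} {x y : Fin m → ℝ}
    (hx : OrbE α N r a x) (hy : OrbE α N r b y) : OrbE α N r (a + b) (x + y) := by
  obtain ⟨j, hj, k, hk⟩ := hx
  obtain ⟨j', hj', k', hk'⟩ := hy
  refine ⟨j + j', ?_, k + k', fun i => ?_⟩
  · have := abs_add_le j j'
    push_cast
    linarith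
  · have h1 := hk i
    have h2 := hk' i
    have h3 := abs_add_le (x i - j * α i - k i) (y i - j' * α i - k' i)
    have h4 : (x + y) i - ((j + j' : ℤ) : ℝ) * α i - ((k + k') i : ℤ)
        = (x i - j * α i - k i) + (y i - j' * α i - k' i) := by
      simp only [Pi.add_apply]; push_cast; ring
    rw [h4]; push_cast; linarith

lemma OrbE.neg {m : ℕ} {α : Fin m → ℝ} {N : ℕ} {r : ℝ} {a : ℕ} {x : Fin m → ℝ}
    (hx : OrbE α N r a x) : OrbE α N r a (-x) := by
  obtain ⟨j, hj, k, hk⟩ := hx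
  refine ⟨-j, by rwa [abs_neg], -k, fun i => ?_⟩
  have h4 : (-x) i - ((-j : ℤ) : ℝ) * α i - ((-k) i : ℤ) = -(x i - j * α i - k i) := by
    simp only [Pi.neg_apply]; push_cast; ring
  rw [h4, abs_neg]; exact hk i

lemma OrbE.mono {m : ℕ} {α : Fin m → ℝ} {N : ℕ} {r : ℝ} (hr : 0 ≤ r) {a b : ℕ} (hab : a ≤ b)
    {x : Fin m → ℝ} (hx : OrbE α N r a x) : OrbE α N r b x := by
  obtain ⟨j, hj, k, hk⟩ := hx
  refine ⟨j, hj.trans ?_, k, fun i => (hk i).trans ?_⟩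
  · gcongr
  · gcongr

/-- Growth step: if `E_v` is not everything then `E_{v+1}` is strictly bigger. -/
lemma OrbE.step {m : ℕ} {α : Fin m → ℝ} {N : ℕ} {r : ℝ} (hr : 0 < r) {v : ℕ}
    {x : Fin m → ℝ} (hx : ¬ OrbE α N r v x) :
    ∃ p, OrbE α N r (v + 1) p ∧ ¬ OrbE α N r v p := by
  by_contra! h
  apply hx
  obtain ⟨L, hL⟩ := exists_nat_gt (‖x‖ / r)
  have hL0 : (0 : ℝ) < L := lt_of_le_of_lt (by positivity) hL
  have hstep : OrbE α N r 1 ((1 / (L : ℝ)) • x) := by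
    refine ⟨0, by simp, 0, fun i => ?_⟩
    have h1 : |x i| ≤ ‖x‖ := by simpa using norm_le_pi_norm x i
    have h2 : ‖x‖ < L * r := by rwa [div_lt_iff₀ hr] at hL
    simp only [Pi.smul_apply, smul_eq_mul, Int.cast_zero, zero_mul, sub_zero, Pi.zero_apply,
      Nat.cast_one, one_mul]
    rw [abs_mul, abs_of_pos (by positivity), one_div, inv_mul_le_iff₀ hL0]
    linarith
  have key : ∀ n : ℕ, OrbE α N r v ((n / (L : ℝ)) • x) := by
    intro n
    induction n with
    | zero =>
      refine ⟨0, by simp; positivity, 0, fun i => ?_⟩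
      simp; positivity
    | succ n ih =>
      apply h
      have := ih.add hstep
      convert this using 1
      rw [← add_smul]
      congr 1
      push_cast; ring
  have := key L
  rwa [div_self hL0.ne', one_smul] at this

/-- Two reals in the same box mod 1. -/
lemma same_box {M : ℕ} (hM : 0 < M) {u v r : ℝ} (hMr : 1 / (M : ℝ) < r)
    (h : ⌊(M : ℝ) * Int.fract u⌋ = ⌊(M : ℝ) * Int.fract v⌋) :
    |u - v - ((⌊u⌋ - ⌊v⌋ : ℤ) : ℝ)| < r := by
  have hM' : (0 : ℝ) < M := by exact_mod_cast hM
  have h1 := Int.abs_sub_lt_one_of_floor_eq_floor h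
  rw [← mul_sub, abs_mul, abs_of_pos hM'] at h1
  have h2 : u - v - ((⌊u⌋ - ⌊v⌋ : ℤ) : ℝ) = Int.fract u - Int.fract v := by
    unfold Int.fract; push_cast; ring
  rw [h2]
  refine lt_of_lt_of_le ?_ hMr.le
  rw [lt_div_iff₀ hM']; linarith

lemma OrbE.all {m : ℕ} (hm : 1 ≤ m) {α : Fin m → ℝ} {c : ℝ} (hc : 0 < c)
    (hbad : ∀ q : ℕ, 1 ≤ q → ∀ p : Fin m → ℤ,
      ∃ i : Fin m, c * (q : ℝ) ^ (-(1 / (m : ℝ))) ≤ |(q : ℝ) * α i - (p i : ℝ)|)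
    {T : ℕ} (hT : (1 / c + 1) ^ m < T) {N : ℕ} (hN : 1 ≤ N) (x : Fin m → ℝ) :
    OrbE α N (c * (N : ℝ) ^ (-(1 / (m : ℝ)))) (2 * T) x := by
  have hN0 : (0 : ℝ) < N := by exact_mod_cast hN
  have hm0 : (m : ℝ) ≠ 0 := by positivity
  set r := c * (N : ℝ) ^ (-(1 / (m : ℝ))) with hrdef
  have hr : 0 < r := by positivity
  by_contra hx
  have hp : ∀ a : Fin T, ∃ p, OrbE α N r (2 * a + 1) p ∧ ¬ OrbE α N r (2 * a) p := fun a =>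
    OrbE.step hr (x := x) (fun h => hx (h.mono hr.le (by omega)))
  choose p hp1 hp2 using hp
  have hsep : ∀ a b : Fin T, a < b → ¬ OrbE α N r 1 (p b - p a) := by
    intro a b hab h
    apply hp2 b
    have := (hp1 a).add h
    rw [add_sub_cancel] at this
    exact this.mono hr.le (by omega)
  have hsep' : ∀ a b : Fin T, a ≠ b → ¬ OrbE α N r 1 (p b - p a) := by
    intro a b hab h
    rcases lt_or_gt_of_ne hab with h1 | h1
    · exact hsep a b h1 h
    · apply hsep b a h1
      simpa using h.neg
  obtain ⟨M, hMdef⟩ : ∃ M : ℕ, M = ⌊1 / r⌋₊ + 1 := ⟨_, rfl⟩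
  have hM : 0 < M := by omega
  have hM' : (0 : ℝ) < M := by exact_mod_cast hM
  have hMr : 1 / (M : ℝ) < r := by
    have := Nat.lt_floor_add_one (1 / r)
    rw [div_lt_iff₀ hM']
    rw [div_lt_iff₀ hr] at this
    rw [hMdef]; push_cast; linarith
  have hMle : (M : ℝ) ≤ (N : ℝ) ^ (1 / (m : ℝ)) * (1 / c + 1) := by
    have h1 : (M : ℝ) ≤ 1 / r + 1 := by
      rw [hMdef]; push_cast
      have := Nat.floor_le (a := 1 / r) (by positivity)
      linarith
    have h2 : 1 / r = (N : ℝ) ^ (1 / (m : ℝ)) * (1 / c) := by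
      rw [hrdef, Real.rpow_neg hN0.le]; field_simp
    have h3 : 1 ≤ (N : ℝ) ^ (1 / (m : ℝ)) :=
      Real.one_le_rpow (by exact_mod_cast hN) (by positivity)
    rw [h2] at h1; linarith
  have hcard : M ^ m < T * N := by
    have : ((M : ℝ)) ^ m < T * N := by
      calc (M : ℝ) ^ m ≤ ((N : ℝ) ^ (1 / (m : ℝ)) * (1 / c + 1)) ^ m := by gcongr
        _ = N * (1 / c + 1) ^ m := by
          rw [mul_pow, ← Real.rpow_natCast, ← Real.rpow_mul hN0.le, one_div_mul_cancel hm0,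
            Real.rpow_one]
        _ < N * T := by gcongr
        _ = T * N := mul_comm _ _
    exact_mod_cast this
  let pt : Fin T × Fin N → Fin m → ℝ := fun w i => p w.1 i + (w.2 : ℕ) * α i
  let box : Fin T × Fin N → (Fin m → Fin M) := fun w i =>
    ⟨⌊(M : ℝ) * Int.fract (pt w i)⌋.toNat, by
      have h0 : 0 ≤ ⌊(M : ℝ) * Int.fract (pt w i)⌋ := Int.floor_nonneg.2 (by positivity)
      have h1 : ⌊(M : ℝ) * Int.fract (pt w i)⌋ < M := by
        rw [Int.floor_lt]; push_cast
        have := Int.fract_lt_one (pt w i)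
        nlinarith
      omega⟩
  obtain ⟨w, w', hne, hbox⟩ := Fintype.exists_ne_map_eq_of_card_lt box (by simpa using hcard)
  have hclose : ∀ i, |pt w i - pt w' i - ((⌊pt w i⌋ - ⌊pt w' i⌋ : ℤ) : ℝ)| < r := by
    intro i
    apply same_box hM hMr
    have h := congrArg Fin.val (congrFun hbox i)
    simp only [box] at h
    have h0 : 0 ≤ ⌊(M : ℝ) * Int.fract (pt w i)⌋ := Int.floor_nonneg.2 (by positivity)
    have h0' : 0 ≤ ⌊(M : ℝ) * Int.fract (pt w' i)⌋ := Int.floor_nonneg.2 (by positivity)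
    omega
  -- same orbit segment: contradicts bad approximability
  have hself : ∀ (a : Fin T) (s t : ℕ), s < t → t < N →
      ∀ k : Fin m → ℤ, ¬ ∀ i, |(p a i + t * α i) - (p a i + s * α i) - k i| < r := by
    intro a s t hst ht k hk
    obtain ⟨i, hi⟩ := hbad (t - s) (by omega) k
    have h1 := hk i
    have h2 : r ≤ c * ((t - s : ℕ) : ℝ) ^ (-(1 / (m : ℝ))) := by
      rw [hrdef]
      gcongr ?_ * ?_
      apply Real.rpow_le_rpow_of_nonpos
      · exact_mod_cast (by omega : 0 < t - s)
      · exact_mod_cast (by omega : t - s ≤ N)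
      · have : 0 ≤ 1 / (m : ℝ) := by positivity
        linarith
    rw [Nat.cast_sub hst.le] at hi h2
    have h3 : (p a i + t * α i) - (p a i + s * α i) - k i = ((t : ℝ) - s) * α i - k i := by ring
    rw [h3] at h1
    linarith
  obtain ⟨a, s⟩ := w
  obtain ⟨b, t⟩ := w'
  by_cases hab : a = b
  · subst hab
    have hst : (s : ℕ) ≠ t := fun h => hne (by rw [Fin.ext h])
    rcases lt_or_gt_of_ne hst with h | h
    · refine hself a s t h t.2 (fun i => ⌊pt (a, t) i⌋ - ⌊pt (a, s) i⌋) (fun i => ?_)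
      have := hclose i
      rw [← abs_neg] at this
      convert this using 2
      simp only [pt]; push_cast; ring
    · exact hself a t s h s.2 (fun i => ⌊pt (a, s) i⌋ - ⌊pt (a, t) i⌋) (fun i => hclose i)
  · apply hsep' b a (Ne.symm hab)
    refine ⟨(t : ℕ) - (s : ℕ), ?_, fun i => ⌊pt (a, s) i⌋ - ⌊pt (b, t) i⌋, fun i => ?_⟩
    · have := s.2
      have := t.2
      rw [abs_le]; constructor <;> push_cast <;> omega
    · have := (hclose i).le
      rw [Nat.cast_one, one_mul]
      refine le_of_eq_of_le (congrArg abs ?_) this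
      simp only [pt, Pi.sub_apply]; push_cast; ring

/-- Quantitative density of finite orbits of a badly approximable toral
translation: for every `0 < θ < 1/m²` the orbit segment of length `N` of the
translation by `α` on `ℝ^m/ℤ^m` is `C·N^{-θ}`-dense. -/
theorem stmt_3 (m : ℕ) (hm : 1 ≤ m) (α : Fin m → ℝ)
    (hbad : ∃ c : ℝ, 0 < c ∧ ∀ q : ℕ, 1 ≤ q → ∀ p : Fin m → ℤ,
      ∃ i : Fin m, c * (q : ℝ) ^ (-(1 / (m : ℝ))) ≤ |(q : ℝ) * α i - (p i : ℝ)|) :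
    ∀ θ : ℝ, 0 < θ → θ < 1 / (m : ℝ) ^ 2 →
      ∃ C : ℝ, 0 < C ∧ ∀ N : ℕ, 1 ≤ N → ∀ y z : Fin m → ℝ,
        ∃ j : ℕ, j < N ∧ ∃ k : Fin m → ℤ,
          ‖z - y - (j : ℝ) • α - (fun i => (k i : ℝ))‖ ≤ C * (N : ℝ) ^ (-θ) := by
  intro θ hθ hθm
  obtain ⟨c, hc, hbad⟩ := hbad
  obtain ⟨T, hT⟩ := exists_nat_gt ((1 / c + 1) ^ m)
  have hT0 : (0 : ℝ) < T := lt_trans (by positivity) hT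
  have hT1 : 1 ≤ T := by exact_mod_cast hT0
  have hm1 : (1 : ℝ) ≤ m := by exact_mod_cast hm
  have hθ1 : θ ≤ 1 / (m : ℝ) := by
    refine hθm.le.trans ?_
    apply one_div_le_one_div_of_le (by positivity)
    nlinarith
  have hm2 : 1 / (m : ℝ) ≤ 1 := by
    rw [div_le_one (by positivity)]; exact hm1
  refine ⟨2 * T * c * (8 * T) + 4 * T, by positivity, fun N hN y z => ?_⟩
  have hN1 : (1 : ℝ) ≤ N := by exact_mod_cast hN
  have hN0 : (0 : ℝ) < N := by linarith
  have hpos : 0 < (N : ℝ) ^ (-θ) := by positivity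
  obtain ⟨n, hn⟩ : ∃ n, n = (N - 1) / (4 * T) := ⟨_, rfl⟩
  have hdm := Nat.div_add_mod (N - 1) (4 * T)
  have hmod := Nat.mod_lt (N - 1) (show 0 < 4 * T by omega)
  rw [← hn] at hdm
  rcases Nat.eq_zero_or_pos n with h0 | hnpos
  · have hNT : N ≤ 4 * T := by rw [h0] at hdm; omega
    refine ⟨0, hN, fun i => ⌊z i - y i⌋, ?_⟩
    have h1 : ‖z - y - ((0 : ℕ) : ℝ) • α - (fun i => ((⌊z i - y i⌋ : ℤ) : ℝ))‖ ≤ 1 := by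
      rw [pi_norm_le_iff_of_nonneg zero_le_one]
      intro i
      simp only [Nat.cast_zero, zero_smul, sub_zero, Pi.sub_apply, Real.norm_eq_abs]
      rw [abs_le]
      have := Int.floor_le (z i - y i)
      have := Int.lt_floor_add_one (z i - y i)
      constructor <;> linarith
    refine h1.trans ?_
    have h2 : (N : ℝ) ^ (-1 : ℝ) ≤ (N : ℝ) ^ (-θ) :=
      Real.rpow_le_rpow_of_exponent_le hN1 (by linarith)
    rw [Real.rpow_neg_one] at h2
    have h3 : (N : ℝ) ≤ 4 * T := by exact_mod_cast hNT
    have h4 : 1 ≤ 4 * T * (N : ℝ) ^ (-θ) := by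
      calc (1 : ℝ) = N * (N : ℝ)⁻¹ := (mul_inv_cancel₀ hN0.ne').symm
        _ ≤ 4 * T * (N : ℝ) ^ (-θ) := by gcongr
    have h5 : 0 ≤ 2 * T * c * (8 * T) * (N : ℝ) ^ (-θ) := by positivity
    linarith
  · obtain ⟨j, hj, k, hk⟩ := OrbE.all hm hc hbad hT hnpos
      (z - y - ((2 * T * n : ℕ) : ℝ) • α)
    have hn0 : (0 : ℝ) < n := by exact_mod_cast hnpos
    rw [abs_le] at hj
    have hjn : 0 ≤ j + 2 * T * n := by have := hj.1; push_cast at this; linarith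
    obtain ⟨J, hJ⟩ := Int.eq_ofNat_of_zero_le hjn
    refine ⟨J, ?_, k, ?_⟩
    · have h1 := hj.2
      push_cast at h1
      have h2 : (J : ℤ) ≤ ((4 * T * n : ℕ) : ℤ) := by push_cast; linarith
      have h3 : J ≤ 4 * T * n := by exact_mod_cast h2
      omega
    · have hb : (n : ℝ) ^ (-(1 / (m : ℝ))) ≤ 8 * T * (N : ℝ) ^ (-θ) := by
        have hNn : (N : ℝ) ≤ 8 * T * n := by
          have h1 : N ≤ 4 * T * n + 4 * T := by omega
          have h2 : 4 * T ≤ 4 * T * n := Nat.le_mul_of_pos_right _ hnpos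
          have h3 : N ≤ 8 * T * n := by linarith
          exact_mod_cast h3
        have h8 : (1 : ℝ) ≤ 8 * T := by
          have : (1 : ℝ) ≤ T := by exact_mod_cast hT1
          linarith
        calc (n : ℝ) ^ (-(1 / (m : ℝ))) ≤ ((N : ℝ) / (8 * T)) ^ (-(1 / (m : ℝ))) := by
              apply Real.rpow_le_rpow_of_nonpos (by positivity)
              · rw [div_le_iff₀ (by positivity)]; linarith
              · have : 0 ≤ 1 / (m : ℝ) := by positivity
                linarith
          _ = (8 * T : ℝ) ^ (1 / (m : ℝ)) * (N : ℝ) ^ (-(1 / (m : ℝ))) := by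
              rw [Real.div_rpow hN0.le (by positivity), Real.rpow_neg (by positivity : (0:ℝ) ≤ 8 * T)]
              field_simp
          _ ≤ (8 * T : ℝ) ^ (1 : ℝ) * (N : ℝ) ^ (-θ) := by
              gcongr
          _ = _ := by rw [Real.rpow_one]
      rw [pi_norm_le_iff_of_nonneg (by positivity)]
      intro i
      have h1 := hk i
      have hJ' : (J : ℝ) = j + 2 * T * n := by exact_mod_cast hJ.symm
      have h2 : (z - y - (J : ℝ) • α - (fun i => (k i : ℝ))) i
          = (z - y - ((2 * T * n : ℕ) : ℝ) • α) i - j * α i - k i := by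
        simp only [Pi.sub_apply, Pi.smul_apply, smul_eq_mul, hJ']; push_cast; ring
      rw [h2, Real.norm_eq_abs]
      refine h1.trans ?_
      have h3 : ((2 * T : ℕ) : ℝ) * (c * (n : ℝ) ^ (-(1 / (m : ℝ))))
          ≤ 2 * T * (c * (8 * T * (N : ℝ) ^ (-θ))) := by
        push_cast; gcongr
      have h4 : 0 ≤ 4 * T * (N : ℝ) ^ (-θ) := by positivity
      linarith
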